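/- arXiv:2002.00724 — 3 statements merged into one kernel-verified Lean document; each statement's English description precedes it below -/
import Mathlib

section
/- Let (N, M) be a pair of real random variables whose joint distribution is a centered bivariate Gaussian in which N and M each have variance 1 and the correlation of N and M is ρ ∈ [-1, 1]. Then P(N > 0 and M > 0) = 1/4 + arcsin(ρ)/(2π), which equals arccos(−ρ)/(2π). -/
open MeasureTheory ProbabilityTheory Real

/-- `(N, M)` is a standardized bivariate Gaussian pair with correlation `ρ`:
the joint law is a centered Gaussian on `ℝ²` with `E[N²] = E[M²] = 1` and `E[N·M] = ρ`,
characterized (Cramér–Wold) by every linear combination `a·N + b·M` being a centered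
Gaussian with variance `a² + 2abρ + b²`. -/
def IsStdBivariateGaussian {Ω : Type*} [MeasureSpace Ω] (N M : Ω → ℝ) (ρ : ℝ) : Prop :=
  ∀ a b : ℝ,
    Measure.map (fun ω => a * N ω + b * M ω) ℙ =
      gaussianReal 0 (a ^ 2 + 2 * a * b * ρ + b ^ 2).toNNReal

/-- A linear combination of two independent standard Gaussians is a centered Gaussian. -/
lemma map_linear_combination_prod_gaussianReal (a b : ℝ) :
    ((gaussianReal 0 1).prod (gaussianReal 0 1)).map (fun p => a * p.1 + b * p.2) =
      gaussianReal 0 (a ^ 2 + b ^ 2).toNNReal := by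
  have hX : ((gaussianReal 0 1).prod (gaussianReal 0 1)).map (fun p => a * p.1) =
      gaussianReal 0 (a ^ 2).toNNReal := by
    rw [show (fun p : ℝ × ℝ => a * p.1) = (fun x => a * x) ∘ Prod.fst from rfl,
      ← Measure.map_map (by fun_prop) (by fun_prop),
      Measure.map_fst_prod, measure_univ, one_smul, gaussianReal_map_const_mul]
    congr 1
    · simp
    · ext; simp [sq_nonneg]
  have hY : ((gaussianReal 0 1).prod (gaussianReal 0 1)).map (fun p => b * p.2) =
      gaussianReal 0 (b ^ 2).toNNReal := by
    rw [show (fun p : ℝ × ℝ => b * p.2) = (fun x => b * x) ∘ Prod.snd from rfl,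
      ← Measure.map_map (by fun_prop) (by fun_prop),
      Measure.map_snd_prod, measure_univ, one_smul, gaussianReal_map_const_mul]
    congr 1
    · simp
    · ext; simp [sq_nonneg]
  have hXY : IndepFun (fun p : ℝ × ℝ => a * p.1) (fun p => b * p.2)
      ((gaussianReal 0 1).prod (gaussianReal 0 1)) :=
    indepFun_prod (X := fun x => a * x) (Y := fun y => b * y) (by fun_prop) (by fun_prop)
  have h := gaussianReal_add_gaussianReal_of_indepFun hXY hX hY
  rw [add_zero, ← Real.toNNReal_add (sq_nonneg a) (sq_nonneg b)] at h
  exact h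

/-- Cramér–Wold in the plane: a finite measure on `ℝ × ℝ` is determined by its images under the
linear forms `p ↦ a * p.1 + b * p.2`. -/
lemma MeasureTheory.Measure.ext_of_map_linear_combination {μ ν : Measure (ℝ × ℝ)}
    [IsFiniteMeasure μ] [IsFiniteMeasure ν]
    (h : ∀ a b : ℝ, μ.map (fun p => a * p.1 + b * p.2) = ν.map (fun p => a * p.1 + b * p.2)) :
    μ = ν := by
  refine Measure.ext_of_charFunDual (funext fun L => ?_)
  have hL : (L : ℝ × ℝ → ℝ) = fun p => L (1, 0) * p.1 + L (0, 1) * p.2 := by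
    ext p
    have hp : p = p.1 • ((1, 0) : ℝ × ℝ) + p.2 • ((0, 1) : ℝ × ℝ) := by ext <;> simp
    conv_lhs => rw [hp]
    simp only [map_add, map_smul, smul_eq_mul]
    ring
  rw [charFunDual_eq_charFun_map_one, charFunDual_eq_charFun_map_one, hL, h]

lemma integral_Ioi_mul_exp_neg_sq_div_two :
    ∫ r in Set.Ioi (0 : ℝ), r * rexp (-r ^ 2 / 2) = 1 := by
  have h := integral_rpow_mul_exp_neg_mul_rpow (p := 2) (q := 1) (b := 1 / 2)
    (by norm_num) (by norm_num) (by norm_num)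
  norm_num at h
  rw [← h]
  refine integral_congr_ae (Filter.Eventually.of_forall fun r => ?_)
  simp only
  ring_nf

/-- The standard Gaussian measure of a sector of the plane is proportional to its angle. -/
lemma measureReal_prod_gaussianReal_of_polar {W : Set (ℝ × ℝ)} (hW : MeasurableSet W)
    {S : Set ℝ} (hS : MeasurableSet S) (hS_sub : S ⊆ Set.Ioo (-π) π)
    (h : ∀ r > 0, ∀ θ ∈ Set.Ioo (-π) π, (r * cos θ, r * sin θ) ∈ W ↔ θ ∈ S) :
    ((gaussianReal 0 1).prod (gaussianReal 0 1)).real W = volume.real S / (2 * π) := by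
  have hdens : (gaussianReal 0 1).prod (gaussianReal 0 1) =
      (volume : Measure (ℝ × ℝ)).withDensity
        (fun p => gaussianPDF 0 1 p.1 * gaussianPDF 0 1 p.2) := by
    rw [gaussianReal_of_var_ne_zero 0 one_ne_zero,
      prod_withDensity (measurable_gaussianPDF 0 1) (measurable_gaussianPDF 0 1)]
    rfl
  have hpdf : ∀ x y : ℝ, (gaussianPDF 0 1 x * gaussianPDF 0 1 y).toReal =
      (2 * π)⁻¹ * rexp (-(x ^ 2 + y ^ 2) / 2) := by
    intro x y
    rw [ENNReal.toReal_mul, toReal_gaussianPDF, toReal_gaussianPDF, gaussianPDFReal,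
      gaussianPDFReal, mul_mul_mul_comm, ← mul_inv, ← Real.exp_add]
    simp only [NNReal.coe_one, mul_one, sub_zero]
    rw [Real.mul_self_sqrt (by positivity)]
    ring_nf
  calc ((gaussianReal 0 1).prod (gaussianReal 0 1)).real W
      = ∫ p, (gaussianPDF 0 1 p.1 * gaussianPDF 0 1 p.2).toReal • W.indicator (1 : ℝ × ℝ → ℝ) p := by
        rw [← integral_indicator_one hW, hdens, integral_withDensity_eq_integral_toReal_smul]
        · exact ((measurable_gaussianPDF 0 1).comp measurable_fst).mul
            ((measurable_gaussianPDF 0 1).comp measurable_snd)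
        · exact Filter.Eventually.of_forall fun p =>
            ENNReal.mul_lt_top gaussianPDF_lt_top gaussianPDF_lt_top
    _ = ∫ p in Set.Ioi (0 : ℝ) ×ˢ Set.Ioo (-π) π,
          (p.1 * rexp (-p.1 ^ 2 / 2)) * ((2 * π)⁻¹ * S.indicator (1 : ℝ → ℝ) p.2) := by
        rw [← integral_comp_polarCoord_symm, polarCoord_target]
        refine setIntegral_congr_fun (measurableSet_Ioi.prod measurableSet_Ioo) ?_
        rintro ⟨r, θ⟩ ⟨hr, hθ⟩
        have hind : W.indicator (1 : ℝ × ℝ → ℝ) (r * cos θ, r * sin θ) =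
            S.indicator (1 : ℝ → ℝ) θ := by
          classical
          simp only [Set.indicator_apply, h r hr θ hθ, Pi.one_apply]
        have hsq : (r * cos θ) ^ 2 + (r * sin θ) ^ 2 = r ^ 2 := by
          linear_combination r ^ 2 * Real.sin_sq_add_cos_sq θ
        simp only [polarCoord_symm_apply, hpdf, smul_eq_mul, hind, hsq]
        ring
    _ = volume.real S / (2 * π) := by
        rw [Measure.volume_eq_prod, setIntegral_prod_mul (fun r : ℝ => r * rexp (-r ^ 2 / 2))
          (fun θ => (2 * π)⁻¹ * S.indicator (1 : ℝ → ℝ) θ), integral_Ioi_mul_exp_neg_sq_div_two,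
          integral_const_mul, integral_indicator_one hS, measureReal_restrict_apply hS,
          Set.inter_eq_left.mpr hS_sub]
        ring

lemma cos_pos_and_cos_sub_pos_iff {φ θ : ℝ} (hφ : φ ∈ Set.Icc 0 π) (hθ : θ ∈ Set.Ioo (-π) π) :
    0 < cos θ ∧ 0 < cos (θ - φ) ↔ θ ∈ Set.Ioo (φ - π / 2) (π / 2) := by
  obtain ⟨hφ₀, hφ₁⟩ := hφ
  obtain ⟨hθ₀, hθ₁⟩ := hθ
  constructor
  · rintro ⟨hc, hd⟩
    have hlt : θ < π / 2 := by
      by_contra! hle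
      exact hc.not_ge (cos_nonpos_of_pi_div_two_le_of_le hle (by linarith))
    have hgt : -(π / 2) < θ := by
      by_contra! hle
      rw [← cos_neg] at hc
      exact hc.not_ge (cos_nonpos_of_pi_div_two_le_of_le (by linarith) (by linarith))
    refine ⟨?_, hlt⟩
    by_contra! hle
    rw [← cos_neg] at hd
    exact hd.not_ge (cos_nonpos_of_pi_div_two_le_of_le (by linarith) (by linarith))
  · rintro ⟨h₀, h₁⟩
    exact ⟨cos_pos_of_mem_Ioo ⟨by linarith, h₁⟩, cos_pos_of_mem_Ioo ⟨by linarith, by linarith⟩⟩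

/-- The joint law of a standardized bivariate Gaussian pair with correlation `cos φ` is the law of
`(X, cos φ * X + sin φ * Y)` for independent standard Gaussians `X` and `Y`. -/
lemma IsStdBivariateGaussian.map_prodMk {Ω : Type*} [MeasureSpace Ω]
    [IsProbabilityMeasure (ℙ : Measure Ω)] {N M : Ω → ℝ} {φ : ℝ}
    (hN : AEMeasurable N) (hM : AEMeasurable M) (h : IsStdBivariateGaussian N M (cos φ)) :
    Measure.map (fun ω => (N ω, M ω)) ℙ =
      ((gaussianReal 0 1).prod (gaussianReal 0 1)).map
        (fun p => (p.1, cos φ * p.1 + sin φ * p.2)) := by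
  have : IsProbabilityMeasure (Measure.map (fun ω => (N ω, M ω)) ℙ) :=
    Measure.isProbabilityMeasure_map (hN.prodMk hM)
  have : IsProbabilityMeasure (((gaussianReal 0 1).prod (gaussianReal 0 1)).map
      (fun p : ℝ × ℝ => (p.1, cos φ * p.1 + sin φ * p.2))) :=
    Measure.isProbabilityMeasure_map (by fun_prop)
  refine Measure.ext_of_map_linear_combination fun a b => ?_
  rw [AEMeasurable.map_map_of_aemeasurable (by fun_prop) (hN.prodMk hM),
    Measure.map_map (by fun_prop) (by fun_prop)]
  have hcomp : (fun p : ℝ × ℝ => a * p.1 + b * p.2) ∘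
      (fun p : ℝ × ℝ => (p.1, cos φ * p.1 + sin φ * p.2)) =
      fun p => (a + b * cos φ) * p.1 + (b * sin φ) * p.2 := by
    ext p
    simp only [Function.comp_apply]
    ring
  have hvar : (a + b * cos φ) ^ 2 + (b * sin φ) ^ 2 = a ^ 2 + 2 * a * b * cos φ + b ^ 2 := by
    linear_combination b ^ 2 * Real.sin_sq_add_cos_sq φ
  rw [hcomp, map_linear_combination_prod_gaussianReal, hvar]
  exact h a b

theorem stmt_0 {Ω : Type*} [MeasureSpace Ω] [IsProbabilityMeasure (ℙ : Measure Ω)]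
    (N M : Ω → ℝ) (ρ : ℝ) (hρ : ρ ∈ Set.Icc (-1 : ℝ) 1)
    (hGauss : IsStdBivariateGaussian N M ρ) :
    (ℙ {ω | 0 < N ω ∧ 0 < M ω}).toReal = 1 / 4 + Real.arcsin ρ / (2 * π) ∧
      1 / 4 + Real.arcsin ρ / (2 * π) = Real.arccos (-ρ) / (2 * π) := by
  have hN : AEMeasurable N := by
    have h := hGauss 1 0
    simp only [one_mul, zero_mul, add_zero] at h
    exact aemeasurable_of_map_neZero (by rw [h]; infer_instance)
  have hM : AEMeasurable M := by
    have h := hGauss 0 1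
    simp only [one_mul, zero_mul, zero_add] at h
    exact aemeasurable_of_map_neZero (by rw [h]; infer_instance)
  have hφ : arccos ρ ∈ Set.Icc 0 π := ⟨arccos_nonneg ρ, arccos_le_pi ρ⟩
  have hlaw := IsStdBivariateGaussian.map_prodMk (φ := arccos ρ) hN hM
    (by rwa [cos_arccos hρ.1 hρ.2])
  have hQ : MeasurableSet {p : ℝ × ℝ | 0 < p.1 ∧ 0 < p.2} :=
    (measurableSet_lt measurable_const measurable_fst).inter
      (measurableSet_lt measurable_const measurable_snd)
  have hlin : Measurable fun p : ℝ × ℝ =>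
      (p.1, cos (arccos ρ) * p.1 + sin (arccos ρ) * p.2) := by fun_prop
  have hsector := measureReal_prod_gaussianReal_of_polar (hlin hQ)
    (measurableSet_Ioo (a := arccos ρ - π / 2) (b := π / 2))
    (Set.Ioo_subset_Ioo (by linarith [hφ.1, pi_pos]) (by linarith [pi_pos]))
    (fun r hr θ hθ => by
      have hcos : cos (arccos ρ) * (r * cos θ) + sin (arccos ρ) * (r * sin θ) =
          r * cos (θ - arccos ρ) := by
        rw [Real.cos_sub]; ring
      rw [← cos_pos_and_cos_sub_pos_iff hφ hθ]
      simp only [Set.mem_preimage, Set.mem_ofPred_eq, hcos, mul_pos_iff_of_pos_left hr])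
  rw [Real.volume_real_Ioo_of_le (by linarith [hφ.2])] at hsector
  refine ⟨?_, ?_⟩
  · calc (ℙ {ω | 0 < N ω ∧ 0 < M ω}).toReal
        = (Measure.map (fun ω => (N ω, M ω)) ℙ {p | 0 < p.1 ∧ 0 < p.2}).toReal := by
          rw [Measure.map_apply_of_aemeasurable (hN.prodMk hM) hQ]
          rfl
      _ = (π / 2 - (arccos ρ - π / 2)) / (2 * π) := by
          rw [hlaw, Measure.map_apply hlin hQ]
          exact hsector
      _ = 1 / 4 + Real.arcsin ρ / (2 * π) := by
          rw [arccos_eq_pi_div_two_sub_arcsin]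
          field_simp
          ring
  · rw [arccos_eq_pi_div_two_sub_arcsin, Real.arcsin_neg]
    field_simp
    ring
end

section
/- Let (N, M) be a pair of real random variables whose joint distribution is a centered bivariate Gaussian in which N and M each have variance 1 and the correlation of N and M is ρ ∈ [-1, 1]. Then P(N·M > 0) = 1/2 + arcsin(ρ)/π. -/
open MeasureTheory ProbabilityTheory Real

/-- The joint law of `(X, Y)` is determined by the laws of the linear combinations of `X`, `Y`. -/
lemma map_prodMk_eq_of_forall_map_linear_eq {Ω Ω' : Type*} [MeasurableSpace Ω] [MeasurableSpace Ω']
    {P : Measure Ω} {Q : Measure Ω'} [IsFiniteMeasure P] [IsFiniteMeasure Q]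
    {X Y : Ω → ℝ} {X' Y' : Ω' → ℝ} (hX : AEMeasurable X P) (hY : AEMeasurable Y P)
    (hX' : AEMeasurable X' Q) (hY' : AEMeasurable Y' Q)
    (h : ∀ a b : ℝ, P.map (fun ω => a * X ω + b * Y ω) = Q.map (fun ω => a * X' ω + b * Y' ω)) :
    P.map (fun ω => (X ω, Y ω)) = Q.map (fun ω => (X' ω, Y' ω)) := by
  apply Measure.ext_of_charFunDual
  ext L
  obtain ⟨a, b, hL⟩ : ∃ a b : ℝ, ∀ p, L p = a * p.1 + b * p.2 := by
    refine ⟨L (1, 0), L (0, 1), fun p => ?_⟩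
    have hp : p = p.1 • ((1 : ℝ), (0 : ℝ)) + p.2 • ((0 : ℝ), (1 : ℝ)) := by ext <;> simp
    conv_lhs => rw [hp, map_add, map_smul, map_smul]
    simp only [smul_eq_mul]
    ring
  rw [charFunDual_eq_charFun_map_one, charFunDual_eq_charFun_map_one,
    AEMeasurable.map_map_of_aemeasurable (by fun_prop) (by fun_prop),
    AEMeasurable.map_map_of_aemeasurable (by fun_prop) (by fun_prop)]
  simp only [Function.comp_def, hL, h]

/-- Linear combinations of two independent standard Gaussians are Gaussian. -/
lemma map_linear_gaussianReal_prod (a b : ℝ) :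
    ((gaussianReal 0 1).prod (gaussianReal 0 1)).map (fun p : ℝ × ℝ => a * p.1 + b * p.2) =
      gaussianReal 0 (a ^ 2 + b ^ 2).toNNReal := by
  apply Measure.ext_of_charFun
  ext t
  rw [charFun_gaussianReal, charFun_apply, integral_map (by fun_prop) (by fun_prop)]
  have hsplit (p : ℝ × ℝ) : Complex.exp ((inner ℝ (a * p.1 + b * p.2) t : ℝ) * Complex.I) =
      Complex.exp (((t * a : ℝ) : ℂ) * p.1 * Complex.I) *
        Complex.exp (((t * b : ℝ) : ℂ) * p.2 * Complex.I) := by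
    rw [← Complex.exp_add]
    congr 1
    simp
    ring
  simp_rw [hsplit]
  rw [integral_prod_mul (fun x : ℝ => Complex.exp (((t * a : ℝ) : ℂ) * x * Complex.I))
    (fun x : ℝ => Complex.exp (((t * b : ℝ) : ℂ) * x * Complex.I)), ← charFun_apply_real,
    ← charFun_apply_real, charFun_gaussianReal, charFun_gaussianReal, ← Complex.exp_add,
    Real.coe_toNNReal _ (by positivity)]
  congr 1
  push_cast
  ring

/-- The standard Gaussian measure of a planar cone is proportional to its angular measure. -/
lemma gaussianReal_prod_cone {S : Set (ℝ × ℝ)} {A : Set ℝ} (hS : MeasurableSet S)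
    (hA : MeasurableSet A)
    (hSA : ∀ r θ : ℝ, 0 < r → θ ∈ Set.Ioo (-π) π → ((r * cos θ, r * sin θ) ∈ S ↔ θ ∈ A)) :
    (gaussianReal 0 1).prod (gaussianReal 0 1) S * ENNReal.ofReal (2 * π) =
      volume (A ∩ Set.Ioo (-π) π) := by
  set h : ℝ → ENNReal := fun r =>
    ENNReal.ofReal r * ENNReal.ofReal ((√(2 * π))⁻¹ * (√(2 * π))⁻¹ * rexp (-r ^ 2 / 2)) with hh
  have key : ∀ {S : Set (ℝ × ℝ)} {A : Set ℝ}, MeasurableSet S → MeasurableSet A →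
      (∀ r θ : ℝ, 0 < r → θ ∈ Set.Ioo (-π) π → ((r * cos θ, r * sin θ) ∈ S ↔ θ ∈ A)) →
      (gaussianReal 0 1).prod (gaussianReal 0 1) S =
        (∫⁻ r in Set.Ioi 0, h r) * volume (A ∩ Set.Ioo (-π) π) := by
    intro S A hS hA hSA
    rw [gaussianReal_of_var_ne_zero 0 one_ne_zero, prod_withDensity (by fun_prop) (by fun_prop),
      withDensity_apply _ hS, ← lintegral_indicator hS, ← Measure.volume_eq_prod,
      ← lintegral_comp_polarCoord_symm]
    have hpt : ∀ p ∈ polarCoord.target, ENNReal.ofReal p.1 •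
        S.indicator (fun z : ℝ × ℝ => gaussianPDF 0 1 z.1 * gaussianPDF 0 1 z.2)
          (polarCoord.symm p) = h p.1 * A.indicator 1 p.2 := by
      rintro ⟨r, θ⟩ ⟨hr, hθ⟩
      have hmem := hSA r θ hr hθ
      simp only [polarCoord_symm_apply]
      by_cases hθA : θ ∈ A
      · rw [Set.indicator_of_mem (hmem.2 hθA), Set.indicator_of_mem hθA]
        simp only [hh, gaussianPDF, gaussianPDFReal, smul_eq_mul, Pi.one_apply, mul_one]
        rw [← ENNReal.ofReal_mul (by positivity)]
        congr 2
        have hexp : rexp (-r ^ 2 / 2) =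
            rexp (-(r * cos θ) ^ 2 / 2) * rexp (-(r * sin θ) ^ 2 / 2) := by
          rw [← Real.exp_add]
          congr 1
          linear_combination (r ^ 2 / 2) * Real.sin_sq_add_cos_sq θ
        rw [hexp]
        simp
        ring
      · rw [Set.indicator_of_notMem (fun hc => hθA (hmem.1 hc)), Set.indicator_of_notMem hθA]
        simp
    rw [setLIntegral_congr_fun polarCoord.open_target.measurableSet hpt, polarCoord_target,
      Measure.volume_eq_prod, ← Measure.prod_restrict,
      lintegral_prod_mul (by fun_prop) (by fun_prop (disch := assumption)),
      lintegral_indicator_one hA, Measure.restrict_apply hA]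
  have huniv := key (S := Set.univ) (A := Set.univ) MeasurableSet.univ MeasurableSet.univ (by simp)
  rw [measure_univ, Set.univ_inter, Real.volume_Ioo, sub_neg_eq_add, ← two_mul] at huniv
  rw [key hS hA hSA, mul_right_comm, ← huniv, one_mul]

lemma setOf_cos_mul_sin_add_pos_inter_Ioo {α : ℝ} (hα : α ∈ Set.Icc (-(π / 2)) (π / 2)) :
    {θ | 0 < cos θ * sin (α + θ)} ∩ Set.Ioo (-π) π =
      Set.Ioo (max (-π) (-π - α)) (-(π / 2)) ∪ (Set.Ioo (-α) (π / 2) ∪ Set.Ioo (π - α) π) := by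
  obtain ⟨h1, h2⟩ := hα
  have hpi := Real.pi_pos
  have hneg {x : ℝ} (hx : π ≤ x) (hx' : x ≤ 2 * π) : sin x ≤ 0 := by
    have := Real.sin_nonneg_of_nonneg_of_le_pi (x := x - π) (by linarith) (by linarith)
    rw [Real.sin_sub_pi] at this
    linarith
  have hneg' {x : ℝ} (hx : π < x) (hx' : x < 2 * π) : sin x < 0 := by
    have := Real.sin_pos_of_pos_of_lt_pi (x := x - π) (by linarith) (by linarith)
    rw [Real.sin_sub_pi] at this
    linarith
  have hcneg {x : ℝ} (hx : x ∈ Set.Ioo (-π) π) (hx' : x < -(π / 2) ∨ π / 2 < x) : cos x < 0 := by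
    rcases hx' with hx' | hx'
    · rw [← Real.cos_neg]
      exact Real.cos_neg_of_pi_div_two_lt_of_lt (by linarith) (by linarith [hx.1])
    · exact Real.cos_neg_of_pi_div_two_lt_of_lt hx' (by linarith [hx.2])
  ext θ
  simp only [Set.mem_inter_iff, Set.mem_ofPred_eq, Set.mem_Ioo, Set.mem_union, max_lt_iff]
  constructor
  · rintro ⟨hpos, hl, hr⟩
    rcases lt_trichotomy θ (-(π / 2)) with hlt | rfl | hgt
    · left
      have hs := neg_of_mul_pos_right hpos (hcneg ⟨hl, hr⟩ (Or.inl hlt)).le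
      refine ⟨⟨hl, ?_⟩, hlt⟩
      by_contra! hc
      have := hneg (x := -(α + θ)) (by linarith) (by linarith)
      rw [Real.sin_neg] at this
      linarith
    · simp at hpos
    · right
      rcases lt_trichotomy θ (π / 2) with hlt | rfl | hgt'
      · left
        have hs := pos_of_mul_pos_right hpos (Real.cos_pos_of_mem_Ioo ⟨hgt, hlt⟩).le
        refine ⟨?_, hlt⟩
        by_contra! hc
        have := Real.sin_nonpos_of_nonpos_of_neg_pi_le (x := α + θ) (by linarith) (by linarith)
        linarith
      · simp at hpos
      · right
        have hs := neg_of_mul_pos_right hpos (hcneg ⟨hl, hr⟩ (Or.inr hgt')).le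
        refine ⟨?_, hr⟩
        by_contra! hc
        have := Real.sin_nonneg_of_nonneg_of_le_pi (x := α + θ) (by linarith) (by linarith)
        linarith
  · rintro (⟨⟨hl, hl'⟩, hr⟩ | ⟨hl, hr⟩ | ⟨hl, hr⟩)
    · exact ⟨mul_pos_of_neg_of_neg (hcneg ⟨hl, by linarith⟩ (Or.inl hr))
        (Real.sin_neg_of_neg_of_neg_pi_lt (by linarith) (by linarith)), hl, by linarith⟩
    · exact ⟨mul_pos (Real.cos_pos_of_mem_Ioo ⟨by linarith, hr⟩)
        (Real.sin_pos_of_pos_of_lt_pi (by linarith) (by linarith)), by linarith, by linarith⟩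
    · exact ⟨mul_pos_of_neg_of_neg (hcneg ⟨by linarith, hr⟩ (Or.inr (by linarith)))
        (hneg' (by linarith) (by linarith)), by linarith, hr⟩

lemma volume_setOf_cos_mul_sin_add_pos {α : ℝ} (hα : α ∈ Set.Icc (-(π / 2)) (π / 2)) :
    volume ({θ | 0 < cos θ * sin (α + θ)} ∩ Set.Ioo (-π) π) = ENNReal.ofReal (π + 2 * α) := by
  rw [setOf_cos_mul_sin_add_pos_inter_Ioo hα]
  obtain ⟨h1, h2⟩ := hα
  have hpi := Real.pi_pos
  rw [measure_union _ (measurableSet_Ioo.union measurableSet_Ioo),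
    measure_union _ measurableSet_Ioo, Real.volume_Ioo, Real.volume_Ioo, Real.volume_Ioo]
  · rcases le_total 0 α with h | h
    · rw [max_eq_left (by linarith), ← ENNReal.ofReal_add (by linarith) (by linarith),
        ← ENNReal.ofReal_add (by linarith) (by linarith)]
      congr 1
      ring
    · rw [max_eq_right (by linarith), ENNReal.ofReal_of_nonpos (p := π - (π - α)) (by linarith),
        add_zero, ← ENNReal.ofReal_add (by linarith) (by linarith)]
      congr 1
      ring
  · rw [Set.disjoint_left]
    rintro x ⟨_, hx⟩ ⟨hx', _⟩
    linarith
  · rw [Set.disjoint_left]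
    rintro x ⟨_, hx⟩ (⟨hx', _⟩ | ⟨hx', _⟩) <;> linarith

theorem stmt_1 {Ω : Type*} [MeasureSpace Ω] [IsProbabilityMeasure (ℙ : Measure Ω)]
    (N M : Ω → ℝ) (ρ : ℝ) (hρ : ρ ∈ Set.Icc (-1 : ℝ) 1)
    (hGauss : IsStdBivariateGaussian N M ρ) :
    (ℙ {ω | 0 < N ω * M ω}).toReal = 1 / 2 + Real.arcsin ρ / π := by
  have hlin (a b : ℝ) : AEMeasurable (fun ω => a * N ω + b * M ω) (ℙ : Measure Ω) := by
    refine AEMeasurable.of_map_ne_zero ?_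
    rw [hGauss a b]
    exact IsProbabilityMeasure.ne_zero _
  have hN : AEMeasurable N (ℙ : Measure Ω) := by simpa using hlin 1 0
  have hM : AEMeasurable M (ℙ : Measure Ω) := by simpa using hlin 0 1
  set α := Real.arcsin ρ with hα
  have hsin : sin α = ρ := Real.sin_arcsin hρ.1 hρ.2
  have hmap : (ℙ : Measure Ω).map (fun ω => (N ω, M ω)) =
      ((gaussianReal 0 1).prod (gaussianReal 0 1)).map
        (fun p : ℝ × ℝ => (p.1, sin α * p.1 + cos α * p.2)) := by
    refine map_prodMk_eq_of_forall_map_linear_eq hN hM (by fun_prop) (by fun_prop) fun a b => ?_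
    have hcomb : (fun p : ℝ × ℝ => a * p.1 + b * (sin α * p.1 + cos α * p.2)) =
        fun p => (a + b * sin α) * p.1 + (b * cos α) * p.2 := by
      ext p
      ring
    rw [hGauss a b, hcomb, map_linear_gaussianReal_prod]
    congr 2
    rw [← hsin]
    linear_combination -b ^ 2 * Real.sin_sq_add_cos_sq α
  have hT : MeasurableSet {p : ℝ × ℝ | 0 < p.1 * p.2} :=
    measurableSet_lt (by fun_prop) (by fun_prop)
  have hP : ℙ {ω | 0 < N ω * M ω} = (gaussianReal 0 1).prod (gaussianReal 0 1)
      {p : ℝ × ℝ | 0 < p.1 * (sin α * p.1 + cos α * p.2)} := by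
    have := congrArg (fun μ => μ {p : ℝ × ℝ | 0 < p.1 * p.2}) hmap
    rwa [Measure.map_apply_of_aemeasurable (hN.prodMk hM) hT,
      Measure.map_apply (by fun_prop) hT] at this
  have hcone := gaussianReal_prod_cone
    (S := {p : ℝ × ℝ | 0 < p.1 * (sin α * p.1 + cos α * p.2)})
    (A := {θ | 0 < cos θ * sin (α + θ)})
    (measurableSet_lt (by fun_prop) (by fun_prop)) (measurableSet_lt (by fun_prop) (by fun_prop))
    (by
      intro r θ hr _
      have hfactor : r * cos θ * (sin α * (r * cos θ) + cos α * (r * sin θ)) =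
          r ^ 2 * (cos θ * sin (α + θ)) := by
        rw [Real.sin_add]
        ring
      simp only [Set.mem_ofPred_eq, hfactor]
      exact mul_pos_iff_of_pos_left (by positivity))
  have hαI : α ∈ Set.Icc (-(π / 2)) (π / 2) := Real.arcsin_mem_Icc ρ
  rw [← hP, volume_setOf_cos_mul_sin_add_pos hαI] at hcone
  have hreal := congrArg ENNReal.toReal hcone
  have hpi := Real.pi_pos
  rw [ENNReal.toReal_mul, ENNReal.toReal_ofReal (by positivity),
    ENNReal.toReal_ofReal (by linarith [hαI.1])] at hreal
  field_simp
  linarith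
end

section
/- Let W¹ and W³ be independent standard Brownian motions, let ρ ∈ [−1, 1] and θ ∈ ℝ, and define W²_u := ρ·W¹_{u+θ} + √(1 − ρ²)·W³_{u+θ} for u with u + θ ≥ 0. Let 0 ≤ a < b and c < d with c + θ ≥ 0, set p := W¹_b − W¹_a and q := W²_d − W²_c, and let L := max(0, min(b, d + θ) − max(a, c + θ)) be the length of the overlap of [a, b] and [c + θ, d + θ]. Then E[sign(p)·sign(q)] = (2/π)·arcsin(ρ·L / √((b − a)·(d − c))); in particular this expectation is zero whenever [a, b] and [c + θ, d + θ] are disjoint. -/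
open MeasureTheory ProbabilityTheory Real

/-- A standard Brownian motion on `[0, ∞)`: a centered Gaussian process with continuous
sample paths and covariance function `Cov(W_s, W_t) = min s t`.  Gaussianity, centering and
the covariance structure are expressed through the law of finite linear combinations. -/
def IsStdBrownianMotion {Ω : Type*} [MeasureSpace Ω] (W : ℝ → Ω → ℝ) : Prop :=
  (∀ ω, ContinuousOn (fun τ => W τ ω) (Set.Ici 0)) ∧
  ∀ (k : ℕ) (c : Fin k → ℝ) (τ : Fin k → ℝ), (∀ i, 0 ≤ τ i) →
    Measure.map (fun ω => ∑ i, c i * W (τ i) ω) ℙ =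
      gaussianReal 0 (∑ i, ∑ j, c i * c j * min (τ i) (τ j)).toNNReal

/-- `W₁` and `W₃` are independent standard Brownian motions on `[0, ∞)`: each is a standard
Brownian motion and they are jointly Gaussian with zero cross-covariance, expressed through
the law of finite linear combinations of values of both processes. -/
def AreIndepStdBrownianMotions {Ω : Type*} [MeasureSpace Ω] (W₁ W₃ : ℝ → Ω → ℝ) : Prop :=
  IsStdBrownianMotion W₁ ∧ IsStdBrownianMotion W₃ ∧
  ∀ (k l : ℕ) (c : Fin k → ℝ) (e : Fin l → ℝ) (τ : Fin k → ℝ) (υ : Fin l → ℝ),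
    (∀ i, 0 ≤ τ i) → (∀ j, 0 ≤ υ j) →
    Measure.map (fun ω => (∑ i, c i * W₁ (τ i) ω) + ∑ j, e j * W₃ (υ j) ω) ℙ =
      gaussianReal 0 ((∑ i, ∑ j, c i * c j * min (τ i) (τ j)) +
        ∑ i, ∑ j, e i * e j * min (υ i) (υ j)).toNNReal

/-- The covariance of two real random variables. -/
noncomputable def cov {Ω : Type*} [MeasureSpace Ω] (X Y : Ω → ℝ) : ℝ :=
  ∫ ω, (X ω - ∫ ω', X ω' ∂ℙ) * (Y ω - ∫ ω', Y ω' ∂ℙ) ∂ℙ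

lemma measurable_realSign : Measurable Real.sign := by
  unfold Real.sign
  exact Measurable.ite measurableSet_Iio measurable_const
    (Measurable.ite measurableSet_Ioi measurable_const measurable_const)

lemma abs_realSign_le_one (x : ℝ) : |Real.sign x| ≤ 1 := by
  rcases Real.sign_apply_eq x with h | h | h <;> rw [h] <;> norm_num

lemma realSign_mul_of_pos {r : ℝ} (hr : 0 < r) (x : ℝ) : Real.sign (r * x) = Real.sign x := by
  rcases lt_trichotomy x 0 with h | h | h
  · rw [Real.sign_of_neg h, Real.sign_of_neg (mul_neg_of_pos_of_neg hr h)]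
  · simp [h]
  · rw [Real.sign_of_pos h, Real.sign_of_pos (mul_pos hr h)]

lemma intervalIntegrable_sign_cos_mul_sign_sin (α x y : ℝ) :
    IntervalIntegrable (fun φ => Real.sign (cos φ) * Real.sign (sin (φ + α))) volume x y := by
  refine (intervalIntegrable_const (c := (1 : ℝ))).mono_fun ?_ (ae_of_all _ fun φ => ?_)
  · exact ((measurable_realSign.comp (by fun_prop)).mul
      (measurable_realSign.comp (by fun_prop))).aestronglyMeasurable
  · simp only [norm_mul, norm_one]
    exact mul_le_one₀ (abs_realSign_le_one _) (norm_nonneg _) (abs_realSign_le_one _)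

/-- The average over the circle of the product of the signs of two sinusoids. -/
lemma integral_sign_cos_mul_sign_sin {α : ℝ} (hα : α ∈ Set.Icc (-(π / 2)) (π / 2)) :
    ∫ φ in Set.Ioo (-π) π, Real.sign (cos φ) * Real.sign (sin (φ + α)) = 4 * α := by
  obtain ⟨h1, h2⟩ := hα
  have hpi := pi_pos
  set g : ℝ → ℝ := fun φ => Real.sign (cos φ) * Real.sign (sin (φ + α)) with hg
  have hint : ∀ x y, IntervalIntegrable g volume x y :=
    intervalIntegrable_sign_cos_mul_sign_sin α
  have hper : Function.Periodic g π := by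
    intro φ
    simp only [hg]
    rw [cos_add_pi, show φ + π + α = (φ + α) + π by ring, sin_add_pi, Real.sign_neg,
      Real.sign_neg, neg_mul_neg]
  have hA : ∫ φ in (-(π / 2))..(-α), g φ = -(-α + π / 2) := by
    have : ∫ φ in (-(π / 2))..(-α), g φ = ∫ φ in (-(π / 2))..(-α), (-1 : ℝ) := by
      refine intervalIntegral.integral_congr_Ioo_of_le (by linarith) fun φ hφ => ?_
      simp only [hg]
      rw [Real.sign_of_pos (cos_pos_of_mem_Ioo ⟨by linarith [hφ.1], by linarith [hφ.2]⟩),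
        Real.sign_of_neg (sin_neg_of_neg_of_neg_pi_lt (by linarith [hφ.2]) (by linarith [hφ.1])),
        one_mul]
    rw [this, intervalIntegral.integral_const, smul_eq_mul]
    ring
  have hB : ∫ φ in (-α)..(π / 2), g φ = π / 2 + α := by
    have : ∫ φ in (-α)..(π / 2), g φ = ∫ φ in (-α)..(π / 2), (1 : ℝ) := by
      refine intervalIntegral.integral_congr_Ioo_of_le (by linarith) fun φ hφ => ?_
      simp only [hg]
      rw [Real.sign_of_pos (cos_pos_of_mem_Ioo ⟨by linarith [hφ.1], by linarith [hφ.2]⟩),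
        Real.sign_of_pos (sin_pos_of_pos_of_lt_pi (by linarith [hφ.1]) (by linarith [hφ.2])),
        one_mul]
    rw [this, intervalIntegral.integral_const, smul_eq_mul]
    ring
  have hhalf : ∀ x, ∫ φ in x..(x + π), g φ = 2 * α := by
    intro x
    rw [hper.intervalIntegral_add_eq x (-(π / 2)), show -(π / 2) + π = π / 2 by ring,
      ← intervalIntegral.integral_add_adjacent_intervals (hint _ (-α)) (hint _ _), hA, hB]
    ring
  have hl := hhalf (-π)
  have hr := hhalf 0
  rw [neg_add_cancel] at hl
  rw [zero_add] at hr
  rw [← integral_Ioc_eq_integral_Ioo, ← intervalIntegral.integral_of_le (by linarith),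
    ← intervalIntegral.integral_add_adjacent_intervals (hint _ 0) (hint _ _), hl, hr]
  ring

/-- Sheppard's formula for the standard Gaussian measure on the plane. -/
lemma integral_sign_mul_sign_gaussianReal_prod {α : ℝ} (hα : α ∈ Set.Icc (-(π / 2)) (π / 2)) :
    ∫ z : ℝ × ℝ, Real.sign z.1 * Real.sign (sin α * z.1 + cos α * z.2)
      ∂((gaussianReal 0 1).prod (gaussianReal 0 1)) = 2 / π * α := by
  have hdens : (gaussianReal 0 1).prod (gaussianReal 0 1) =
      (volume : Measure (ℝ × ℝ)).withDensity
        (fun z => gaussianPDF 0 1 z.1 * gaussianPDF 0 1 z.2) := by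
    rw [gaussianReal_of_var_ne_zero 0 one_ne_zero,
      prod_withDensity (measurable_gaussianPDF _ _) (measurable_gaussianPDF _ _)]
    rfl
  rw [hdens, integral_withDensity_eq_integral_toReal_smul
    (by fun_prop)
    (ae_of_all _ fun z => ENNReal.mul_lt_top gaussianPDF_lt_top gaussianPDF_lt_top),
    ← integral_comp_polarCoord_symm]
  have hpt : ∀ p ∈ polarCoord.target,
      p.1 • ((gaussianPDF 0 1 (polarCoord.symm p).1 *
          gaussianPDF 0 1 (polarCoord.symm p).2).toReal •
        (Real.sign (polarCoord.symm p).1 *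
          Real.sign (sin α * (polarCoord.symm p).1 + cos α * (polarCoord.symm p).2))) =
      (p.1 * rexp (-p.1 ^ 2 / 2)) *
        ((2 * π)⁻¹ * (Real.sign (cos p.2) * Real.sign (sin (p.2 + α)))) := by
    rintro ⟨r, φ⟩ ⟨hr, -⟩
    have hr : 0 < r := hr
    have hs : polarCoord.symm (r, φ) = (r * cos φ, r * sin φ) := rfl
    rw [hs]
    simp only [smul_eq_mul, ENNReal.toReal_mul, toReal_gaussianPDF]
    rw [show sin α * (r * cos φ) + cos α * (r * sin φ) = r * sin (φ + α) by
      rw [sin_add]; ring, realSign_mul_of_pos hr, realSign_mul_of_pos hr]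
    have hexp : gaussianPDFReal 0 1 (r * cos φ) * gaussianPDFReal 0 1 (r * sin φ) =
        (2 * π)⁻¹ * rexp (-r ^ 2 / 2) := by
      simp only [gaussianPDFReal, NNReal.coe_one, mul_one, sub_zero]
      rw [mul_mul_mul_comm, ← mul_inv, mul_self_sqrt (by positivity), ← exp_add]
      congr 2
      linear_combination (-r ^ 2 / 2) * sin_sq_add_cos_sq φ
    rw [hexp]
    ring
  rw [setIntegral_congr_fun polarCoord.open_target.measurableSet hpt]
  change ∫ p in Set.Ioi (0 : ℝ) ×ˢ Set.Ioo (-π) π, _ = _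
  rw [Measure.volume_eq_prod, setIntegral_prod_mul (fun r => r * rexp (-r ^ 2 / 2))
    (fun φ => (2 * π)⁻¹ * (Real.sign (cos φ) * Real.sign (sin (φ + α)))),
    integral_const_mul, integral_sign_cos_mul_sign_sin hα, integral_Ioi_mul_exp_neg_sq_div_two]
  have := pi_ne_zero
  field_simp
  ring

/-- A finite measure on the plane is determined by the laws of the linear functionals. -/
lemma measure_prod_ext_of_map_linear {μ ν : Measure (ℝ × ℝ)} [IsFiniteMeasure μ]
    [IsFiniteMeasure ν]
    (h : ∀ t s : ℝ, μ.map (fun z => t * z.1 + s * z.2) = ν.map (fun z => t * z.1 + s * z.2)) :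
    μ = ν := by
  refine Measure.ext_of_charFunDual ?_
  ext L
  have hL : ⇑L = fun z : ℝ × ℝ => L (1, 0) * z.1 + L (0, 1) * z.2 := by
    ext z
    conv_lhs => rw [show z = z.1 • ((1, 0) : ℝ × ℝ) + z.2 • ((0, 1) : ℝ × ℝ) by ext <;> simp]
    rw [map_add, map_smul, map_smul, smul_eq_mul, smul_eq_mul]
    ring
  rw [charFunDual_eq_charFun_map_one, charFunDual_eq_charFun_map_one, hL, h]

lemma gaussianReal_prod_map_linear (A B : ℝ) :
    ((gaussianReal 0 1).prod (gaussianReal 0 1)).map (fun z => A * z.1 + B * z.2) =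
      gaussianReal 0 (A ^ 2 + B ^ 2).toNNReal := by
  have key (C : ℝ) : (gaussianReal 0 1).map (fun x => C * x) =
      gaussianReal 0 (C ^ 2).toNNReal := by
    rw [gaussianReal_map_const_mul, mul_zero, mul_one]
    congr 1
    ext
    simp [sq_nonneg]
  have hind : IndepFun (fun z : ℝ × ℝ => A * z.1) (fun z : ℝ × ℝ => B * z.2)
      ((gaussianReal 0 1).prod (gaussianReal 0 1)) :=
    indepFun_prod (X := fun x => A * x) (Y := fun x => B * x) (by fun_prop) (by fun_prop)
  have h1 : ((gaussianReal 0 1).prod (gaussianReal 0 1)).map (fun z : ℝ × ℝ => A * z.1) =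
      gaussianReal 0 (A ^ 2).toNNReal := by
    rw [← key A, ← measurePreserving_fst (μ := gaussianReal 0 1) (ν := gaussianReal 0 1) |>.map_eq,
      Measure.map_map (by fun_prop) measurable_fst,
      measurePreserving_fst (μ := gaussianReal 0 1) (ν := gaussianReal 0 1) |>.map_eq]
    rfl
  have h2 : ((gaussianReal 0 1).prod (gaussianReal 0 1)).map (fun z : ℝ × ℝ => B * z.2) =
      gaussianReal 0 (B ^ 2).toNNReal := by
    rw [← key B, ← measurePreserving_snd (μ := gaussianReal 0 1) (ν := gaussianReal 0 1) |>.map_eq,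
      Measure.map_map (by fun_prop) measurable_snd,
      measurePreserving_snd (μ := gaussianReal 0 1) (ν := gaussianReal 0 1) |>.map_eq]
    rfl
  have := gaussianReal_add_gaussianReal_of_indepFun hind h1 h2
  rw [Real.toNNReal_add (sq_nonneg _) (sq_nonneg _)]
  rw [add_zero] at this
  exact this

/-- Sheppard's formula: the sign correlation of a centered Gaussian pair `(X, Y)` with variances
`σ ^ 2`, `τ ^ 2` and correlation `r`. -/
lemma integral_sign_mul_sign_of_map_linear {Ω : Type*} [MeasurableSpace Ω] {P : Measure Ω}
    [IsProbabilityMeasure P] {X Y : Ω → ℝ} {σ τ r : ℝ} (hσ : 0 < σ) (hτ : 0 < τ)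
    (hr : r ∈ Set.Icc (-1 : ℝ) 1)
    (h : ∀ t s : ℝ, P.map (fun ω => t * X ω + s * Y ω) =
      gaussianReal 0 (t ^ 2 * σ ^ 2 + 2 * t * s * (r * (σ * τ)) + s ^ 2 * τ ^ 2).toNNReal) :
    ∫ ω, Real.sign (X ω) * Real.sign (Y ω) ∂P = 2 / π * arcsin r := by
  have hae (t s : ℝ) : AEMeasurable (fun ω => t * X ω + s * Y ω) P := by
    apply AEMeasurable.of_map_ne_zero
    rw [h]
    exact NeZero.ne _
  have hX : AEMeasurable X P := by simpa using hae 1 0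
  have hY : AEMeasurable Y P := by simpa using hae 0 1
  set α := arcsin r
  set T : ℝ × ℝ → ℝ × ℝ := fun z => (σ * z.1, τ * (sin α * z.1 + cos α * z.2)) with hT
  have hTm : Measurable T := by fun_prop
  have hsin : sin α = r := sin_arcsin hr.1 hr.2
  have hlaw : P.map (fun ω => (X ω, Y ω)) =
      ((gaussianReal 0 1).prod (gaussianReal 0 1)).map T := by
    have := Measure.isProbabilityMeasure_map (hX.prodMk hY)
    have := Measure.isProbabilityMeasure_map
      (μ := (gaussianReal 0 1).prod (gaussianReal 0 1)) hTm.aemeasurable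
    refine measure_prod_ext_of_map_linear fun t s => ?_
    rw [AEMeasurable.map_map_of_aemeasurable (by fun_prop) (hX.prodMk hY),
      Measure.map_map (by fun_prop) hTm]
    have h1 : ((fun z : ℝ × ℝ => t * z.1 + s * z.2) ∘ T) =
        fun z => (t * σ + s * τ * sin α) * z.1 + (s * τ * cos α) * z.2 := by
      ext z
      simp only [hT, Function.comp_apply]
      ring
    rw [h1, gaussianReal_prod_map_linear]
    refine (h t s).trans ?_
    congr 2
    rw [mul_pow _ (cos α), cos_sq', hsin]
    ring
  have hm : Measurable fun z : ℝ × ℝ => Real.sign z.1 * Real.sign z.2 :=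
    (measurable_realSign.comp measurable_fst).mul (measurable_realSign.comp measurable_snd)
  calc ∫ ω, Real.sign (X ω) * Real.sign (Y ω) ∂P
      = ∫ z, Real.sign z.1 * Real.sign z.2 ∂(P.map fun ω => (X ω, Y ω)) :=
        (integral_map (hX.prodMk hY) hm.aestronglyMeasurable).symm
    _ = ∫ z : ℝ × ℝ, Real.sign z.1 * Real.sign (sin α * z.1 + cos α * z.2)
          ∂((gaussianReal 0 1).prod (gaussianReal 0 1)) := by
        rw [hlaw, integral_map hTm.aemeasurable hm.aestronglyMeasurable]
        simp only [hT, realSign_mul_of_pos hσ, realSign_mul_of_pos hτ]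
    _ = 2 / π * α :=
        integral_sign_mul_sign_gaussianReal_prod ⟨neg_pi_div_two_le_arcsin r, arcsin_le_pi_div_two r⟩

/-- The length of the overlap of `[a, b]` and `[c, d]` in terms of the Brownian covariance. -/
lemma overlap_eq_min {a b c d : ℝ} (hab : a ≤ b) (hcd : c ≤ d) :
    max 0 (min b d - max a c) = min b d - min b c - min a d + min a c := by
  rcases le_total a c with h1 | h1 <;> rcases le_total a d with h2 | h2 <;>
    rcases le_total b c with h3 | h3 <;> rcases le_total b d with h4 | h4 <;>
    simp only [min_eq_left, min_eq_right, max_eq_left, max_eq_right, h1, h2, h3, h4] <;>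
    first
    | (rw [max_eq_left (by linarith)]; linarith)
    | (rw [max_eq_right (by linarith)]; linarith)

/-- With `L := max(0, min(b, d + θ) − max(a, c + θ))` the length of the overlap of
`[a, b]` and `[c + θ, d + θ]`, `E[sign(p)·sign(q)] = (2/π)·arcsin(ρ·L / √((b − a)·(d − c)))`
for `p := W¹_b − W¹_a` and `q := W²_d − W²_c`; in particular this expectation is zero
whenever `[a, b]` and `[c + θ, d + θ]` are disjoint. -/
theorem stmt_9 {Ω : Type*} [MeasureSpace Ω] [IsProbabilityMeasure (ℙ : Measure Ω)]
    (W₁ W₃ W₂ : ℝ → Ω → ℝ) (ρ θ : ℝ) (hρ : ρ ∈ Set.Icc (-1 : ℝ) 1)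
    (hBM : AreIndepStdBrownianMotions W₁ W₃)
    (hW₂ : ∀ u : ℝ, 0 ≤ u + θ → ∀ ω,
      W₂ u ω = ρ * W₁ (u + θ) ω + Real.sqrt (1 - ρ ^ 2) * W₃ (u + θ) ω)
    (a b c d : ℝ) (ha : 0 ≤ a) (hab : a < b) (hcd : c < d) (hcθ : 0 ≤ c + θ) :
    (∫ ω, Real.sign (W₁ b ω - W₁ a ω) * Real.sign (W₂ d ω - W₂ c ω) ∂ℙ) =
        2 / π * Real.arcsin (ρ * max 0 (min b (d + θ) - max a (c + θ)) /
          Real.sqrt ((b - a) * (d - c))) ∧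
      (Disjoint (Set.Icc a b) (Set.Icc (c + θ) (d + θ)) →
        (∫ ω, Real.sign (W₁ b ω - W₁ a ω) * Real.sign (W₂ d ω - W₂ c ω) ∂ℙ) = 0) := by
  have hd : c + θ < d + θ := by linarith
  set L := max 0 (min b (d + θ) - max a (c + θ))
  have hLeq : L = min b (d + θ) - min b (c + θ) - min a (d + θ) + min a (c + θ) :=
    overlap_eq_min hab.le hd.le
  have hL0 : 0 ≤ L := le_max_left _ _
  have hLb : L ≤ b - a := max_le (by linarith)
    (by linarith [min_le_left b (d + θ), le_max_left a (c + θ)])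
  have hLd : L ≤ d - c := max_le (by linarith)
    (by linarith [min_le_right b (d + θ), le_max_right a (c + θ)])
  have hσ : 0 < √(b - a) := sqrt_pos.2 (by linarith)
  have hτ : 0 < √(d - c) := sqrt_pos.2 (by linarith)
  have hprod : √((b - a) * (d - c)) = √(b - a) * √(d - c) := sqrt_mul (by linarith) _
  have hLle : L ≤ √((b - a) * (d - c)) :=
    le_sqrt_of_sq_le (by rw [sq]; exact mul_le_mul hLb hLd hL0 (by linarith))
  have hpos : 0 < √((b - a) * (d - c)) := hprod ▸ mul_pos hσ hτ
  have hr : ρ * L / √((b - a) * (d - c)) ∈ Set.Icc (-1 : ℝ) 1 := by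
    rw [Set.mem_Icc, ← abs_le, abs_div, abs_mul, abs_of_nonneg hL0, abs_of_pos hpos]
    refine div_le_one_of_le₀ ?_ hpos.le
    exact (mul_le_of_le_one_left hL0 (abs_le.2 hρ)).trans hLle
  have hmain : ∫ ω, Real.sign (W₁ b ω - W₁ a ω) * Real.sign (W₂ d ω - W₂ c ω) ∂ℙ =
      2 / π * arcsin (ρ * L / √((b - a) * (d - c))) := by
    refine integral_sign_mul_sign_of_map_linear hσ hτ hr fun t s => ?_
    rw [← hprod, div_mul_cancel₀ _ hpos.ne', sq_sqrt (by linarith), sq_sqrt (by linarith)]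
    have h := hBM.2.2 4 2 ![t, -t, s * ρ, -(s * ρ)] ![s * √(1 - ρ ^ 2), -(s * √(1 - ρ ^ 2))]
      ![b, a, d + θ, c + θ] ![d + θ, c + θ]
      (by intro i; fin_cases i <;> simp <;> linarith)
      (by intro i; fin_cases i <;> simp <;> linarith)
    have hρ2 : √(1 - ρ ^ 2) ^ 2 = 1 - ρ ^ 2 :=
      sq_sqrt (by nlinarith [hρ.1, hρ.2])
    convert h using 2
    · ext ω
      rw [hW₂ d (by linarith), hW₂ c hcθ]
      simp [Fin.sum_univ_four]
      ring
    · congr 1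
      simp [Fin.sum_univ_four]
      rw [min_comm a b, min_comm (d + θ) a, min_comm (d + θ) b, min_comm (c + θ) a,
        min_comm (c + θ) b, min_comm (d + θ) (c + θ), min_eq_right hab.le, min_eq_left hd.le,
        hLeq]
      linear_combination (-(s ^ 2 * (d - c))) * hρ2
  refine ⟨hmain, fun hdisj => ?_⟩
  have hL_zero : L = 0 := by
    refine max_eq_left ?_
    by_contra! hlt
    refine Set.disjoint_left.1 hdisj (show max a (c + θ) ∈ _ from ⟨le_max_left _ _, ?_⟩)
      ⟨le_max_right _ _, ?_⟩
    · linarith [min_le_left b (d + θ)]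
    · linarith [min_le_right b (d + θ)]
  rw [hmain, hL_zero]
  simp
end
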